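/- Let G be a discrete groupoid. The map U_g ↦ U_g ⊗ U_g extends to an injective *-homomorphism δ_G : C*(G) → C*(G) ⊗ C*(G), and δ_G is a coaction of G on C*(G). (Injectivity: if H ≥ 0 and δ_G(H) = 0, then U_{1_x} H U_{1_x} = 0 for all objects x, using that U_{1_x}C*(G)U_{1_x} ≅ C*(G(x,x)) and the comultiplication on a discrete group C*-algebra is injective; hence H = 0.) -/

import Mathlib

open CategoryTheory
open scoped Classical

universe v u u₁

def Mor (V : Type v) [Groupoid V] := Σ (x : V) (y : V), x ⟶ y

namespace Mor

variable {V : Type v} [Groupoid V]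

def src (f : Mor V) : V := f.1
def tgt (f : Mor V) : V := f.2.1
def hom (f : Mor V) : f.src ⟶ f.tgt := f.2.2

def comp (g f : Mor V) (h : f.tgt = g.src) : Mor V :=
  ⟨f.src, g.tgt, f.hom ≫ eqToHom h ≫ g.hom⟩

def inv (f : Mor V) : Mor V := ⟨f.tgt, f.src, Groupoid.inv f.hom⟩
def id (x : V) : Mor V := ⟨x, x, 𝟙 x⟩

end Mor

/-- A family of elements of a C*-algebra satisfying the relations of the generators of the
C*-algebra of a discrete groupoid. -/
structure IsGroupoidRep {V : Type*} [Groupoid V] {A : Type*} [NonUnitalCStarAlgebra A]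
    (U : Mor V → A) : Prop where
  mul : ∀ (f g : Mor V) (h : g.tgt = f.src), U f * U g = U (f.comp g h)
  mul_eq_zero : ∀ f g : Mor V, g.tgt ≠ f.src → U f * U g = 0
  star_eq : ∀ f : Mor V, star (U f) = U f.inv

namespace IsGroupoidRep

variable {V : Type*} [Groupoid V] {A : Type*} [NonUnitalCStarAlgebra A] {U : Mor V → A}

lemma mul_mk (hU : IsGroupoidRep U) {x y z : V} (f : x ⟶ y) (g : y ⟶ z) :
    U ⟨y, z, g⟩ * U ⟨x, y, f⟩ = U ⟨x, z, f ≫ g⟩ := by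
  rw [hU.mul ⟨y, z, g⟩ ⟨x, y, f⟩ rfl]
  change U ⟨x, z, f ≫ 𝟙 y ≫ g⟩ = _
  rw [Category.id_comp]

lemma mul_id_src (hU : IsGroupoidRep U) (f : Mor V) : U f * U (Mor.id f.src) = U f := by
  obtain ⟨x, y, f⟩ := f
  exact (hU.mul_mk (𝟙 x) f).trans (by rw [Category.id_comp])

lemma id_tgt_mul (hU : IsGroupoidRep U) (f : Mor V) : U (Mor.id f.tgt) * U f = U f := by
  obtain ⟨x, y, f⟩ := f
  exact (hU.mul_mk f (𝟙 y)).trans (by rw [Category.comp_id])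

lemma inv_mul (hU : IsGroupoidRep U) (f : Mor V) : U f.inv * U f = U (Mor.id f.src) := by
  obtain ⟨x, y, f⟩ := f
  exact (hU.mul_mk f (Groupoid.inv f)).trans (by rw [Groupoid.comp_inv]; rfl)

lemma mul_inv (hU : IsGroupoidRep U) (f : Mor V) : U f * U f.inv = U (Mor.id f.tgt) := by
  obtain ⟨x, y, f⟩ := f
  exact (hU.mul_mk (Groupoid.inv f) f).trans (by rw [Groupoid.inv_comp]; rfl)

lemma id_mul_id (hU : IsGroupoidRep U) (x : V) :
    U (Mor.id x) * U (Mor.id x) = U (Mor.id x) :=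
  hU.mul_id_src (Mor.id x)

lemma star_id (hU : IsGroupoidRep U) (x : V) : star (U (Mor.id x)) = U (Mor.id x) := by
  have h : star (U (Mor.id x)) * U (Mor.id x) = U (Mor.id x) := by
    rw [hU.star_eq]; exact hU.inv_mul (Mor.id x)
  rw [← h, star_mul, star_star]

lemma eq_of_id_eq (hU : IsGroupoidRep U) {x y : V} (h : U (Mor.id x) = U (Mor.id y))
    (hx : U (Mor.id x) ≠ 0) : x = y := by
  by_contra hxy
  apply hx
  have := hU.mul_eq_zero (Mor.id x) (Mor.id y) (fun e => hxy e.symm)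
  rwa [← h, hU.id_mul_id] at this

lemma id_src_ne_zero (hU : IsGroupoidRep U) {f : Mor V} (hf : U f ≠ 0) :
    U (Mor.id f.src) ≠ 0 := fun h => hf (by rw [← hU.mul_id_src, h, mul_zero])

lemma id_tgt_ne_zero (hU : IsGroupoidRep U) {f : Mor V} (hf : U f ≠ 0) :
    U (Mor.id f.tgt) ≠ 0 := fun h => hf (by rw [← hU.id_tgt_mul, h, zero_mul])

lemma ne_zero_of_id_src (hU : IsGroupoidRep U) {f : Mor V} (hf : U (Mor.id f.src) ≠ 0) :
    U f ≠ 0 := fun h => hf (by rw [← hU.inv_mul, h, mul_zero])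

lemma ne_zero_of_id_tgt (hU : IsGroupoidRep U) {f : Mor V} (hf : U (Mor.id f.tgt) ≠ 0) :
    U f ≠ 0 := fun h => hf (by rw [← hU.mul_inv, h, zero_mul])

/-- The trivial representation of a groupoid by matrix units, relative to an orthonormal family
indexed by the unit projections of a given representation. -/
lemma matrixUnits (hU : IsGroupoidRep U) {H : Type*} [NormedAddCommGroup H]
    [InnerProductSpace ℂ H] [CompleteSpace H] {ξ : A → H} (hξ : Orthonormal ℂ ξ) :
    IsGroupoidRep fun f : Mor V => if U f = 0 then (0 : H →L[ℂ] H) else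
      InnerProductSpace.rankOne ℂ (ξ (U (Mor.id f.tgt))) (ξ (U (Mor.id f.src))) where
  mul f g h := by
    by_cases hf : U f = 0
    · have : U (f.comp g h) = 0 := by rw [← hU.mul, hf, zero_mul]
      simp [hf, this]
    · have hg : U g ≠ 0 := hU.ne_zero_of_id_tgt (h ▸ hU.id_src_ne_zero hf)
      have hgs : U (Mor.id g.src) ≠ 0 := hU.id_src_ne_zero hg
      have hfg : U (f.comp g h) ≠ 0 := hU.ne_zero_of_id_src hgs
      simp only [hf, hg, hfg, if_false]
      rw [ContinuousLinearMap.mul_def, InnerProductSpace.rankOne_comp_rankOne, h,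
        inner_self_eq_norm_sq_to_K, hξ.1]
      simp
      rfl
  mul_eq_zero f g h := by
    by_cases hf : U f = 0
    · simp [hf]
    by_cases hg : U g = 0
    · simp [hg]
    simp only [hf, hg, if_false]
    rw [ContinuousLinearMap.mul_def, InnerProductSpace.rankOne_comp_rankOne, hξ.2, zero_smul]
    exact fun e => h (hU.eq_of_id_eq e (hU.id_src_ne_zero hf)).symm
  star_eq f := by
    have h : U f.inv = 0 ↔ U f = 0 := by rw [← hU.star_eq, star_eq_zero]
    by_cases hf : U f = 0
    · simp [hf, h]
    · simp only [hf, h, if_false]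
      rw [ContinuousLinearMap.star_eq_adjoint, InnerProductSpace.adjoint_rankOne]
      rfl

end IsGroupoidRep

/-- Almost invariant elements: if finitely many elements `a` of the corner at the projection `p`
are killed by a representation at a unit vector fixed by `p`, then they are almost killed by
right multiplication with an element of norm between `1` and `2` in the corner. -/
lemma exists_norm_mul_le {A : Type*} [NonUnitalCStarAlgebra A] {H : Type*} [NormedAddCommGroup H]
    [InnerProductSpace ℂ H] [CompleteSpace H] (φ : A →⋆ₙₐ[ℂ] (H →L[ℂ] H)) {ξ : H}
    (hξ : ‖ξ‖ = 1) {p : A} (hp : IsStarProjection p) (hpξ : φ p ξ = ξ) (s : Finset A)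
    (hs : ∀ a ∈ s, φ a ξ = 0 ∧ a * p = a) {ε : ℝ} (hε : 0 < ε) :
    ∃ e : A, p * e = e ∧ 1 ≤ ‖e‖ ∧ ‖e‖ ≤ 2 ∧ ∀ a ∈ s, ‖a * e‖ ≤ ε := by
  let _ := CStarAlgebra.spectralOrder A
  let _ := CStarAlgebra.spectralOrderedRing A
  set b : A := ∑ a ∈ s, star a * a with hb
  have hbsa : IsSelfAdjoint b := isSelfAdjoint_sum _ fun a _ => IsSelfAdjoint.star_mul_self a
  have hbp : b * p = b := by
    rw [hb, Finset.sum_mul]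
    exact Finset.sum_congr rfl fun a ha => by rw [mul_assoc, (hs a ha).2]
  have hpb : p * b = b := by
    have := congrArg star hbp
    rwa [star_mul, hbsa.star_eq, hp.isSelfAdjoint.star_eq] at this
  have hbξ : φ b ξ = 0 := by
    rw [hb, map_sum, sum_apply]
    refine Finset.sum_eq_zero fun a ha => ?_
    rw [map_mul, mul_apply_eq_comp, (hs a ha).1, map_zero]
  set η : ℝ := ε ^ 2 / 2 with hη
  have hη0 : 0 < η := by positivity
  have hden : ∀ t : ℝ, 0 < t ^ 2 + η ^ 2 := fun t => by positivity
  set k : ℝ → ℝ := fun t => t / (t ^ 2 + η ^ 2) with hk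
  have hkc : Continuous k := by
    rw [hk]
    exact continuous_id.div (by fun_prop) fun t => (hden t).ne'
  have hk0 : k 0 = 0 := by simp [hk]
  set c : A := cfcₙ k b with hc
  have hbc : cfcₙ (fun t : ℝ => t * k t) b = b * c := by
    rw [cfcₙ_mul (fun t : ℝ => t) k b (by fun_prop) rfl hkc.continuousOn hk0, cfcₙ_id' ℝ b]
  have hcb : b * c = c * b := by
    rw [← hbc, cfcₙ_congr (g := fun t => k t * t) fun t _ => mul_comm _ _,
      cfcₙ_mul k (fun t : ℝ => t) b hkc.continuousOn hk0 (by fun_prop) rfl, cfcₙ_id' ℝ b]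
  have hbcn : ‖b * c‖ ≤ 1 := by
    rw [← hbc]
    refine norm_cfcₙ_le fun t _ => ?_
    rw [Real.norm_eq_abs, hk, abs_le]
    have := hden t
    have h2 : t * (t / (t ^ 2 + η ^ 2)) = t ^ 2 / (t ^ 2 + η ^ 2) := by ring
    simp only [h2]
    constructor
    · have : 0 ≤ t ^ 2 / (t ^ 2 + η ^ 2) := by positivity
      linarith
    · rw [div_le_one this]; nlinarith
  have hbe : ‖b - b * (b * c)‖ ≤ η := by
    have : b - b * (b * c) = cfcₙ (fun t : ℝ => t - t * (t * k t)) b := by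
      rw [cfcₙ_sub (fun t : ℝ => t) (fun t => t * (t * k t)) b (by fun_prop) rfl
        (by fun_prop) (by simp),
        cfcₙ_mul (fun t : ℝ => t) (fun t => t * k t) b (by fun_prop) rfl (by fun_prop) (by simp),
        hbc, cfcₙ_id' ℝ b]
    rw [this]
    refine norm_cfcₙ_le fun t _ => ?_
    have h := hden t
    have h2 : t - t * (t * k t) = t * η ^ 2 / (t ^ 2 + η ^ 2) := by
      simp only [hk]; field_simp; ring
    rw [h2, Real.norm_eq_abs, abs_div, abs_of_pos h, div_le_iff₀ h, abs_mul,
      abs_of_pos (pow_pos hη0 2)]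
    nlinarith [sq_nonneg (|t| - η), sq_abs t, abs_nonneg t]
  have hpn : ‖p‖ ≤ 1 := hp.norm_le
  have hpe : p * (p - b * c) = p - b * c := by
    rw [mul_sub, hp.isIdempotentElem.eq, ← mul_assoc, hpb]
  have hen : ‖p - b * c‖ ≤ 2 := (norm_sub_le _ _).trans (by linarith)
  refine ⟨p - b * c, hpe, ?_, hen, fun a ha => ?_⟩
  · have h1 : φ (p - b * c) ξ = ξ := by
      rw [hcb, map_sub, map_mul, sub_apply, mul_apply_eq_comp,
        hbξ, hpξ, map_zero, sub_zero]
    calc 1 = ‖φ (p - b * c) ξ‖ := by rw [h1, hξ]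
      _ ≤ ‖φ (p - b * c)‖ * ‖ξ‖ := ContinuousLinearMap.le_opNorm _ _
      _ ≤ ‖p - b * c‖ := by
        rw [hξ, mul_one]; exact NonUnitalStarAlgHom.norm_apply_le φ _
  · set e := p - b * c with he
    have hle : star a * a ≤ b :=
      Finset.single_le_sum (f := fun a : A => star a * a) (fun a _ => star_mul_self_nonneg a) ha
    have h1 : star (a * e) * (a * e) = star e * (star a * a) * e := by
      simp only [star_mul, mul_assoc]
    have h2 : ‖star (a * e) * (a * e)‖ ≤ ‖star e * b * e‖ := by
      refine CStarAlgebra.norm_le_norm_of_nonneg_of_le (star_mul_self_nonneg _) ?_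
      rw [h1]
      exact star_left_conjugate_le_conjugate hle e
    have h3 : b * e = b - b * (b * c) := by rw [he, mul_sub, hbp]
    have h4 : ‖star e * b * e‖ ≤ 2 * η := by
      rw [mul_assoc, h3]
      refine (norm_mul_le _ _).trans ?_
      rw [norm_star]
      gcongr
    rw [CStarRing.norm_star_mul_self] at h2
    refine abs_le_of_sq_le_sq' ?_ hε.le |>.2
    nlinarith

namespace IsGroupoidRep

variable {V : Type*} [Groupoid V] {A T : Type*} [NonUnitalCStarAlgebra A]
  [NonUnitalCStarAlgebra T] {U : Mor V → A}

open Filter Topology in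
/-- A homomorphism `U_g ↦ U_g ⊗ U_g` into a completed tensor product is bounded below on the
corner at each object, provided the trivial representation exists. -/
lemma norm_corner_le (hU : IsGroupoidRep U)
    (hdense : Dense (↑(Submodule.span ℂ (Set.range U)) : Set A))
    {H : Type*} [NormedAddCommGroup H] [InnerProductSpace ℂ H] [CompleteSpace H]
    (φ : A →⋆ₙₐ[ℂ] (H →L[ℂ] H)) (x : V) {ξ : H} (hξ : ‖ξ‖ = 1)
    (hφ : ∀ g : Mor V, g.src = x → g.tgt = x → φ (U g) ξ = ξ)
    (t : A →ₗ[ℂ] A →ₗ[ℂ] T) (ht : ∀ a b u w : A, t a u * t b w = t (a * b) (u * w))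
    (htn : ∀ a u : A, ‖t a u‖ = ‖a‖ * ‖u‖)
    (δ : A →⋆ₙₐ[ℂ] T) (hδ : ∀ g, δ (U g) = t (U g) (U g)) (a : A) :
    ‖U (Mor.id x) * a * U (Mor.id x)‖ ≤
      ‖δ (U (Mor.id x) * a * U (Mor.id x))‖ * (‖U (Mor.id x)‖ * 2) := by
  set p := U (Mor.id x) with hp
  have hpp : p * p = p := hU.id_mul_id x
  have hproj : IsStarProjection p := ⟨hpp, hU.star_id x⟩
  have hgp : ∀ g : Mor V, g.src = x → U g * p = U g := by
    rintro g rfl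
    exact hU.mul_id_src g
  have hpg : ∀ g : Mor V, g.tgt = x → p * U g = U g := by
    rintro g rfl
    exact hU.id_tgt_mul g
  have hφp : φ p ξ = ξ := hφ (Mor.id x) rfl rfl
  have hex : ∀ i : Finset (Mor V) × ℕ, ∃ e : A, 1 ≤ ‖e‖ ∧ ‖e‖ ≤ 2 ∧
      ∀ g ∈ i.1, g.src = x → g.tgt = x → ‖U g * e - e‖ ≤ 1 / ((i.2 : ℝ) + 1) := by
    intro i
    obtain ⟨e, h1, h2, h3, h4⟩ := exists_norm_mul_le φ hξ hproj hφp
      ((i.1.filter fun g => g.src = x ∧ g.tgt = x).image fun g => U g - p) (by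
        intro a ha
        obtain ⟨g, hg, rfl⟩ := Finset.mem_image.1 ha
        obtain ⟨-, hs, ht⟩ := Finset.mem_filter.1 hg
        refine ⟨?_, by rw [sub_mul, hgp g hs, hpp]⟩
        rw [map_sub, sub_apply, hφ g hs ht, hφp, sub_self]) (ε := 1 / ((i.2 : ℝ) + 1))
      (by positivity)
    refine ⟨e, h2, h3, fun g hg hs ht => ?_⟩
    have := h4 _ (Finset.mem_image_of_mem _ (Finset.mem_filter.2 ⟨hg, hs, ht⟩))
    rwa [sub_mul, h1] at this
  choose e he1 he2 he3 using hex
  have hlim : ∀ g : Mor V, g.src = x → g.tgt = x →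
      Tendsto (fun i => U g * e i - e i) atTop (𝓝 0) := by
    intro g hs ht
    have h0 : Tendsto (fun i : Finset (Mor V) × ℕ => 1 / ((i.2 : ℝ) + 1)) atTop (𝓝 0) := by
      rw [← prod_atTop_atTop_eq]
      exact tendsto_one_div_add_atTop_nhds_zero_nat.comp tendsto_snd
    refine squeeze_zero_norm' ?_ h0
    filter_upwards [eventually_ge_atTop (({g} : Finset (Mor V)), 0)] with i hi
    exact he3 i g (hi.1 (Finset.mem_singleton_self g)) hs ht
  have hspan : ∀ y ∈ Submodule.span ℂ (Set.range U),
      Tendsto (fun i => δ (p * y * p) * t p (e i) - t (p * y * p) (e i)) atTop (𝓝 0) := by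
    intro y hy
    induction hy using Submodule.span_induction with
    | mem y hy =>
      obtain ⟨g, rfl⟩ := hy
      by_cases h1 : g.src = x
      · by_cases h2 : g.tgt = x
        · simp only [hpg g h2, hgp g h1, hδ, ht, ← map_sub]
          rw [tendsto_zero_iff_norm_tendsto_zero]
          simp only [htn]
          simpa using (hlim g h1 h2).norm.const_mul ‖U g‖
        · have : p * U g = 0 := hU.mul_eq_zero _ _ h2
          simp [this]
      · have : U g * p = 0 := hU.mul_eq_zero _ _ (Ne.symm h1)
        simp [mul_assoc, this]
    | zero => simp
    | add y z _ _ hy hz =>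
      convert hy.add hz using 2
      · simp only [mul_add, add_mul, map_add, LinearMap.add_apply]; abel
      · simp
    | smul r y _ hy =>
      convert hy.const_smul r using 2
      · simp only [mul_smul_comm, smul_mul_assoc, map_smul, LinearMap.smul_apply, smul_sub]
      · simp
  have hδc : Continuous δ := AddMonoidHomClass.continuous_of_bound δ 1 fun a => by
    simpa only [one_mul] using NonUnitalStarAlgHom.norm_apply_le δ a
  refine hdense.induction (P := fun a => ‖p * a * p‖ ≤ ‖δ (p * a * p)‖ * (‖p‖ * 2)) ?_ ?_ a
  · intro y hy
    have h := (hspan y hy).norm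
    rw [norm_zero] at h
    have h' := h.const_add (‖δ (p * y * p)‖ * (‖p‖ * 2))
    rw [add_zero] at h'
    refine ge_of_tendsto' h' fun i => ?_
    calc ‖p * y * p‖ ≤ ‖p * y * p‖ * ‖e i‖ := le_mul_of_one_le_right (norm_nonneg _) (he1 i)
      _ = ‖t (p * y * p) (e i)‖ := (htn _ _).symm
      _ ≤ ‖δ (p * y * p) * t p (e i)‖
          + ‖δ (p * y * p) * t p (e i) - t (p * y * p) (e i)‖ := norm_le_insert _ _
      _ ≤ _ := by
        gcongr
        refine (norm_mul_le _ _).trans ?_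
        rw [htn]
        gcongr
        exact he2 i
  · exact isClosed_le (by fun_prop) (by fun_prop)

lemma eq_zero_of_mul_id (hU : IsGroupoidRep U)
    (hdense : Dense (↑(Submodule.span ℂ (Set.range U)) : Set A)) {a : A}
    (ha : ∀ x, a * U (Mor.id x) = 0) : a = 0 := by
  have h : ∀ b, a * b = 0 := by
    refine hdense.induction (P := fun b => a * b = 0) (fun b hb => ?_)
      (isClosed_eq (by fun_prop) continuous_const)
    induction hb using Submodule.span_induction with
    | mem b hb =>
      obtain ⟨g, rfl⟩ := hb
      rw [← hU.id_tgt_mul, ← mul_assoc, ha, zero_mul]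
    | zero => simp
    | add y z _ _ hy hz => rw [mul_add, hy, hz, add_zero]
    | smul r y _ hy => rw [mul_smul_comm, hy, smul_zero]
  exact CStarRing.mul_star_self_eq_zero_iff a |>.1 (h _)

end IsGroupoidRep

/-- for a discrete groupoid `G`, the map `U_g ↦ U_g ⊗ U_g`
extends to an injective *-homomorphism `δ_G : C*(G) → C*(G) ⊗ C*(G)`, and
`δ_G` is a coaction of `G` on `C*(G)` (its spectral subspaces have dense
span).  Here `C*(G)` is the full groupoid C*-algebra: it is generated by the
`U_g` and universal for representations of `G` in C*-algebras. -/
theorem statement18 {V : Type v} [Groupoid V]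
    {Cg : Type u} [NonUnitalCStarAlgebra Cg] (U : Mor V → Cg)
    (hUmul : ∀ (f g : Mor V) (h : g.tgt = f.src), U f * U g = U (f.comp g h))
    (hUzero : ∀ f g : Mor V, g.tgt ≠ f.src → U f * U g = 0)
    (hUstar : ∀ f : Mor V, star (U f) = U f.inv)
    (hUdense : Dense (↑(Submodule.span ℂ (Set.range U)) : Set Cg))
    (huniv : ∀ (C : Type u) [NonUnitalCStarAlgebra C], ∀ π : Mor V → C,
      (∀ (f g : Mor V) (h : g.tgt = f.src), π f * π g = π (f.comp g h)) →
      (∀ f g : Mor V, g.tgt ≠ f.src → π f * π g = 0) →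
      (∀ f : Mor V, star (π f) = π f.inv) →
      ∃ φ : Cg →⋆ₙₐ[ℂ] C, ∀ g : Mor V, φ (U g) = π g)
    -- the spatial tensor product `T = C*(G) ⊗ C*(G)`
    {T : Type u} [NonUnitalCStarAlgebra T] (tmul : Cg →ₗ[ℂ] Cg →ₗ[ℂ] T)
    (hTmul : ∀ a b u w : Cg, tmul a u * tmul b w = tmul (a * b) (u * w))
    (hTstar : ∀ a u : Cg, star (tmul a u) = tmul (star a) (star u))
    (hTnorm : ∀ a u : Cg, ‖tmul a u‖ = ‖a‖ * ‖u‖)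
    (hTdense : Dense (↑(Submodule.span ℂ
      (Set.range fun p : Cg × Cg => tmul p.1 p.2)) : Set T)) :
    ∃ δ : Cg →⋆ₙₐ[ℂ] T,
      (∀ g : Mor V, δ (U g) = tmul (U g) (U g)) ∧
      Function.Injective δ ∧
      Dense (↑(Submodule.span ℂ
        (⋃ g : Mor V, {a : Cg | δ a = tmul a (U g)})) : Set Cg) := by
  have hU : IsGroupoidRep U := ⟨hUmul, hUzero, hUstar⟩
  obtain ⟨δ, hδ⟩ := huniv T (fun g => tmul (U g) (U g))
    (fun f g h => by rw [hTmul, hUmul f g h]) (fun f g h => by simp [hTmul, hUzero f g h])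
    (fun f => by rw [hTstar, hUstar])
  have hξ : Orthonormal ℂ fun i : Cg => (lp.single 2 i (1 : ℂ) : lp (fun _ : Cg => ℂ) 2) := by
    rw [orthonormal_iff_ite]
    intro i j
    rw [lp.inner_single_left, lp.single_apply, Pi.single_apply]
    split_ifs <;> simp
  have hrep := hU.matrixUnits hξ
  obtain ⟨φ, hφ⟩ := huniv _ _ hrep.mul hrep.mul_eq_zero hrep.star_eq
  refine ⟨δ, hδ, ?_, ?_⟩
  · rw [injective_iff_map_eq_zero]
    intro a ha
    refine hU.eq_zero_of_mul_id hUdense fun x => ?_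
    by_cases hx : U (Mor.id x) = 0
    · rw [hx, mul_zero]
    · have h := hU.norm_corner_le hUdense φ x (hξ.1 (U (Mor.id x))) (by
        rintro g rfl ht
        have hg : U g ≠ 0 := hU.ne_zero_of_id_src hx
        rw [hφ, if_neg hg, InnerProductSpace.rankOne_apply, inner_self_eq_norm_sq_to_K, hξ.1, ht]
        simp) tmul hTmul hTnorm δ hδ (star a * a)
      rw [map_mul, map_mul, map_mul, ha, mul_zero, mul_zero, zero_mul, norm_zero, zero_mul] at h
      rw [← CStarRing.star_mul_self_eq_zero_iff, star_mul, hU.star_id]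
      simpa [mul_assoc] using h
  · refine hUdense.mono (Submodule.span_mono ?_)
    rintro _ ⟨g, rfl⟩
    exact Set.mem_iUnion.2 ⟨g, hδ g⟩
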